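/- arXiv:1606.06691 — 2 statements merged into one kernel-verified Lean document; each statement's English description precedes it below -/
import Mathlib

section
/- Let n ≥ 1 be an integer, 0 ≤ α ≤ n, β ≥ 1, γ ∈ ℝ, and N ≥ n+β. Then there exists a constant C (depending only on n, α, β, γ, N) such that for every s with 0 < s ≤ 1, every y ∈ ℝⁿ, and every R ≥ 0, ∫_{{w ∈ ℝⁿ : |w| < |y|/2}} ⟨w⟩^{-N} / ( |y−sw|^α ⟨|y−sw|+R⟩^γ ⟨|y−sw|−R⟩^β ) dw ≤ C · ⟨y⟩^{-α} ⟨|y|+R⟩^{-γ} ⟨R−|y|⟩^{-β}. -/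
open MeasureTheory Real
open scoped ENNReal

/-- The Japanese bracket `⟨x⟩ = (1+|x|²)^{1/2}` on Euclidean space. -/
noncomputable def jb {n : ℕ} (x : EuclideanSpace ℝ (Fin n)) : ℝ := Real.sqrt (1 + ‖x‖ ^ 2)

/-- The Japanese bracket `⟨t⟩ = (1+t²)^{1/2}` on the real line. -/
noncomputable def jbr (t : ℝ) : ℝ := Real.sqrt (1 + t ^ 2)

lemma aux_jbr_one_le (t : ℝ) : 1 ≤ jbr t := by
  unfold jbr
  rw [Real.one_le_sqrt]; nlinarith [sq_nonneg t]

lemma aux_jb_eq {n : ℕ} (w : EuclideanSpace ℝ (Fin n)) : jb w = jbr ‖w‖ := rfl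

lemma aux_jbr_le_two {a b : ℝ} (h : 1 + a ^ 2 ≤ 4 * (1 + b ^ 2)) : jbr a ≤ 2 * jbr b := by
  unfold jbr
  apply Real.sqrt_le_iff.2
  refine ⟨by positivity, ?_⟩
  rw [mul_pow, Real.sq_sqrt (by positivity)]
  linarith

lemma aux_le_two_jbr {t : ℝ} : 1 + t ≤ 2 * jbr t := by
  unfold jbr
  have h : (1 + t) / 2 ≤ √(1 + t ^ 2) := by
    apply Real.le_sqrt_of_sq_le
    nlinarith [sq_nonneg (1 - t), sq_nonneg t]
  linarith

lemma aux_jbr_le (t : ℝ) : jbr t ≤ 1 + |t| := by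
  unfold jbr
  apply Real.sqrt_le_iff.2
  refine ⟨by positivity, ?_⟩
  nlinarith [abs_nonneg t, sq_abs t]

lemma aux_rpow {a b p : ℝ} (ha : 0 < a) (hb : 0 < b) (h1 : a ≤ 2 * b) (h2 : b ≤ 2 * a) :
    a ^ p ≤ 2 ^ |p| * b ^ p := by
  rcases le_total 0 p with hp | hp
  · rw [abs_of_nonneg hp, ← Real.mul_rpow (by norm_num) hb.le]
    exact Real.rpow_le_rpow ha.le h1 hp
  · rw [abs_of_nonpos hp]
    have : (2 * a) ^ p ≤ b ^ p := Real.rpow_le_rpow_of_nonpos hb h2 hp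
    rw [Real.mul_rpow (by norm_num) ha.le] at this
    calc a ^ p = 2 ^ (-p) * (2 ^ p * a ^ p) := by
          rw [← mul_assoc, ← Real.rpow_add (by norm_num)]; simp
      _ ≤ _ := by gcongr

/-- one-sided version -/
lemma aux_rpow_neg {a b c p : ℝ} (hc : 0 < c) (ha : 0 < a) (hb : 0 < b) (h : b ≤ c * a)
    (hp : 0 ≤ p) : a ^ (-p) ≤ c ^ p * b ^ (-p) := by
  have : (c * a) ^ (-p) ≤ b ^ (-p) := Real.rpow_le_rpow_of_nonpos hb h (by linarith)
  rw [Real.mul_rpow hc.le ha.le] at this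
  calc a ^ (-p) = c ^ p * (c ^ (-p) * a ^ (-p)) := by
        rw [← mul_assoc, ← Real.rpow_add hc]; simp
    _ ≤ _ := by gcongr

lemma aux_pt {α β γ J r ρ R : ℝ} (hα0 : 0 ≤ α) (hJ : 0 ≤ J) (hr : 0 < r) (hR : 0 ≤ R)
    (h1 : r ≤ 2 * ρ) (h2 : ρ ≤ 2 * r) :
    J / (ρ ^ α * jbr (ρ + R) ^ γ * jbr (ρ - R) ^ β) ≤
      (2 ^ α * 2 ^ |γ|) * (r ^ (-α) * jbr (r + R) ^ (-γ)) * (J * jbr (ρ - R) ^ (-β)) := by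
  have hρ : 0 < ρ := by linarith
  have e1 := aux_jbr_one_le (ρ + R)
  have e2 := aux_jbr_one_le (ρ - R)
  have e3 := aux_jbr_one_le (r + R)
  have k1 : ρ ^ (-α) ≤ 2 ^ α * r ^ (-α) := aux_rpow_neg (by norm_num) hρ hr h1 hα0
  have k2 : jbr (ρ + R) ^ (-γ) ≤ 2 ^ |γ| * jbr (r + R) ^ (-γ) := by
    have := aux_rpow (p := -γ) (a := jbr (ρ + R)) (b := jbr (r + R)) (by linarith) (by linarith)
      (aux_jbr_le_two (by nlinarith)) (aux_jbr_le_two (by nlinarith))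
    rwa [abs_neg] at this
  have : J / (ρ ^ α * jbr (ρ + R) ^ γ * jbr (ρ - R) ^ β) =
      (ρ ^ (-α) * jbr (ρ + R) ^ (-γ)) * (J * jbr (ρ - R) ^ (-β)) := by
    rw [Real.rpow_neg hρ.le, Real.rpow_neg (by linarith), Real.rpow_neg (by linarith)]
    field_simp
  rw [this]
  have e4 : 0 ≤ jbr (ρ - R) ^ (-β) := Real.rpow_nonneg (by linarith) _
  have e5 : 0 ≤ jbr (ρ + R) ^ (-γ) := Real.rpow_nonneg (by linarith) _
  have e6 : 0 ≤ r ^ (-α) := Real.rpow_nonneg (by linarith) _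
  calc _ ≤ ((2 ^ α * r ^ (-α)) * (2 ^ |γ| * jbr (r + R) ^ (-γ))) * (J * jbr (ρ - R) ^ (-β)) := by
        gcongr
    _ = _ := by ring

lemma aux_B {β N m x r ρ R : ℝ} (hm : 0 ≤ m) (hβ : 1 ≤ β) (hN : m + β ≤ N) (hx : 0 ≤ x)
    (h : |ρ - r| ≤ x) :
    jbr x ^ (-N) * jbr (ρ - R) ^ (-β) ≤
      (8 ^ (m + β) * 2 ^ β) * (jbr (R - r) ^ (-β) * (1 + x) ^ (-(m + β)) +
        jbr (R - r) ^ (-(m + β)) * (1 + (jbr (R - r))⁻¹ * x) ^ (-(m + β))) := by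
  have e1 := aux_jbr_one_le x
  have e2 := aux_jbr_one_le (ρ - R)
  have e3 := aux_jbr_one_le (R - r)
  have e4 := aux_le_two_jbr (t := x)
  have e5 := aux_jbr_le (R - r)
  set D := jbr (R - r) with hD
  have hD0 : 0 < D := by linarith
  have p1 : 0 ≤ D ^ (-β) * (1 + x) ^ (-(m + β)) := by positivity
  have p2 : 0 ≤ D ^ (-(m + β)) * (1 + D⁻¹ * x) ^ (-(m + β)) := by positivity
  have hJ : jbr x ^ (-N) ≤ jbr x ^ (-(m + β)) :=
    Real.rpow_le_rpow_of_exponent_le e1 (by linarith)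
  have h2 : (1 : ℝ) ≤ 2 ^ β := Real.one_le_rpow (by norm_num) (by linarith)
  rw [mul_add]
  rcases le_total x (|R - r| / 2) with hc | hc
  · have k1 : jbr (ρ - R) ^ (-β) ≤ 2 ^ β * D ^ (-β) := by
      refine aux_rpow_neg (by norm_num) (by linarith) hD0 ?_ (by linarith)
      apply aux_jbr_le_two
      have : |R - r| ≤ 2 * |ρ - R| := by
        have : |R - r| ≤ |ρ - R| + |ρ - r| := by
          rw [abs_sub_comm ρ R]; exact abs_sub_le R ρ r
        linarith
      nlinarith [sq_abs (R - r), sq_abs (ρ - R), abs_nonneg (R - r)]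
    have k2 : jbr x ^ (-(m + β)) ≤ 8 ^ (m + β) * (1 + x) ^ (-(m + β)) :=
      aux_rpow_neg (by norm_num) (by linarith) (by linarith) (by linarith) (by linarith)
    have : 0 ≤ jbr (ρ - R) ^ (-β) := Real.rpow_nonneg (by linarith) _
    have : jbr x ^ (-N) * jbr (ρ - R) ^ (-β) ≤
        (8 ^ (m + β) * (1 + x) ^ (-(m + β))) * (2 ^ β * D ^ (-β)) := by
      gcongr
      exact hJ.trans k2
    have q : 0 ≤ 8 ^ (m + β) * 2 ^ β * (D ^ (-(m + β)) * (1 + D⁻¹ * x) ^ (-(m + β))) := by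
      positivity
    linarith
  · have k1 : jbr (ρ - R) ^ (-β) ≤ 1 := Real.rpow_le_one_of_one_le_of_nonpos e2 (by linarith)
    have k2 : jbr x ^ (-(m + β)) ≤ 8 ^ (m + β) * (D * (1 + D⁻¹ * x)) ^ (-(m + β)) := by
      refine aux_rpow_neg (by norm_num) (by linarith) (by positivity) ?_ (by linarith)
      have : D * (1 + D⁻¹ * x) = D + x := by field_simp
      rw [this]; linarith
    rw [Real.mul_rpow hD0.le (by positivity)] at k2
    have : 0 ≤ jbr (ρ - R) ^ (-β) := Real.rpow_nonneg (by linarith) _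
    have : jbr x ^ (-N) * jbr (ρ - R) ^ (-β) ≤
        (8 ^ (m + β) * (D ^ (-(m + β)) * (1 + D⁻¹ * x) ^ (-(m + β)))) * 2 ^ β := by
      gcongr
      · exact hJ.trans k2
      · exact k1.trans h2
    have q : 0 ≤ 8 ^ (m + β) * 2 ^ β * (D ^ (-β) * (1 + x) ^ (-(m + β))) := by
      positivity
    linarith

lemma aux_C {β N x r ρ R : ℝ} (hβ : 1 ≤ β) (hN : 0 ≤ N) (h : |ρ - r| ≤ 1 / 2) :
    jbr x ^ (-N) * jbr (ρ - R) ^ (-β) ≤ 2 ^ β * jbr (R - r) ^ (-β) := by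
  have e1 := aux_jbr_one_le x
  have e2 := aux_jbr_one_le (ρ - R)
  have e3 := aux_jbr_one_le (R - r)
  have k1 : jbr (ρ - R) ^ (-β) ≤ 2 ^ β * jbr (R - r) ^ (-β) := by
    refine aux_rpow_neg (by norm_num) (by linarith) (by linarith) ?_ (by linarith)
    apply aux_jbr_le_two
    have h3 : |R - r| ≤ |ρ - R| + |ρ - r| := by
      rw [abs_sub_comm ρ R]; exact abs_sub_le R ρ r
    nlinarith [sq_abs (R - r), sq_abs (ρ - R), abs_nonneg (R - r), abs_nonneg (ρ - R),
      sq_nonneg (|ρ - R| - 1)]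
  have k2 : jbr x ^ (-N) ≤ 1 := Real.rpow_le_one_of_one_le_of_nonpos e1 (by linarith)
  have : 0 ≤ jbr (ρ - R) ^ (-β) := Real.rpow_nonneg (by linarith) _
  nlinarith

set_option maxHeartbeats 1000000 in
theorem stmt_8 (n : ℕ) (hn : 1 ≤ n) (α β γ N : ℝ) (hα0 : 0 ≤ α) (hα : α ≤ n)
    (hβ : 1 ≤ β) (hN : (n : ℝ) + β ≤ N) :
    ∃ C : ℝ, 0 < C ∧ ∀ s : ℝ, 0 < s → s ≤ 1 → ∀ y : EuclideanSpace ℝ (Fin n), ∀ R : ℝ, 0 ≤ R →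
      (∫ w in {w : EuclideanSpace ℝ (Fin n) | ‖w‖ < ‖y‖ / 2},
          jb w ^ (-N) /
            (‖y - s • w‖ ^ α * jbr (‖y - s • w‖ + R) ^ γ * jbr (‖y - s • w‖ - R) ^ β)) ≤
        C * jb y ^ (-α) * jbr (‖y‖ + R) ^ (-γ) * jbr (R - ‖y‖) ^ (-β) := by
  have hn0 : (0 : ℝ) ≤ n := Nat.cast_nonneg n
  set f : EuclideanSpace ℝ (Fin n) → ℝ := fun w => (1 + ‖w‖) ^ (-((n : ℝ) + β)) with hf
  have hfi : Integrable f volume := by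
    apply integrable_one_add_norm
    rw [finrank_euclideanSpace_fin]; linarith
  set I : ℝ := ∫ w, f w with hI
  have hf0 : ∀ w, 0 ≤ f w := fun w => by positivity
  have hI0 : 0 ≤ I := integral_nonneg hf0
  set V : ℝ := volume.real (Metric.ball (0 : EuclideanSpace ℝ (Fin n)) 1) with hV
  have hV0 : 0 ≤ V := measureReal_nonneg
  set K1 : ℝ := 2 ^ α * 2 ^ |γ| with hK1
  have hK10 : 0 < K1 := by positivity
  set K2 : ℝ := 8 ^ ((n : ℝ) + β) * 2 ^ β with hK2
  have hK20 : 0 < K2 := by positivity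
  refine ⟨K1 * (2 ^ α) * (K2 * (I + I) + 2 ^ β * V + 1), by positivity, ?_⟩
  intro s hs hs1 y R hR
  have e3 := aux_jbr_one_le (R - ‖y‖)
  have e4 := aux_jbr_one_le (‖y‖ + R)
  have e5 : 1 ≤ jb y := aux_jbr_one_le ‖y‖
  set D := jbr (R - ‖y‖) with hD
  set G := jbr (‖y‖ + R) with hG
  have hD0 : 0 < D := by linarith
  have hG0 : 0 < G := by linarith
  have hy0 : 0 < jb y := by linarith
  rcases eq_or_lt_of_le (norm_nonneg y) with hy | hy
  · have : {w : EuclideanSpace ℝ (Fin n) | ‖w‖ < ‖y‖ / 2} = ∅ := by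
      ext w
      simp only [← hy, Set.mem_ofPred_eq, Set.mem_empty_iff_false, iff_false, not_lt]
      simp
    rw [this]
    simp only [Measure.restrict_empty, integral_zero_measure]
    clear_value K1 K2 I V D G
    positivity
  have hset : {w : EuclideanSpace ℝ (Fin n) | ‖w‖ < ‖y‖ / 2} = Metric.ball 0 (‖y‖ / 2) := by
    ext w; simp
  rw [hset]
  have hdiff : ∀ w : EuclideanSpace ℝ (Fin n), |‖y - s • w‖ - ‖y‖| ≤ ‖w‖ := by
    intro w
    refine (abs_norm_sub_norm_le _ _).trans ?_
    have : y - s • w - y = -(s • w) := by abel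
    rw [this, norm_neg, norm_smul, Real.norm_of_nonneg hs.le]
    nlinarith [norm_nonneg w]
  have hnn : ∀ w : EuclideanSpace ℝ (Fin n), 0 ≤ jb w ^ (-N) /
      (‖y - s • w‖ ^ α * jbr (‖y - s • w‖ + R) ^ γ * jbr (‖y - s • w‖ - R) ^ β) := by
    intro w
    have a1 : 0 ≤ jb w := Real.sqrt_nonneg _
    have a2 : 0 ≤ jbr (‖y - s • w‖ + R) := Real.sqrt_nonneg _
    have a3 : 0 ≤ jbr (‖y - s • w‖ - R) := Real.sqrt_nonneg _
    positivity
  have hpt : ∀ w ∈ Metric.ball (0 : EuclideanSpace ℝ (Fin n)) (‖y‖ / 2), jb w ^ (-N) /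
      (‖y - s • w‖ ^ α * jbr (‖y - s • w‖ + R) ^ γ * jbr (‖y - s • w‖ - R) ^ β) ≤
      K1 * (‖y‖ ^ (-α) * G ^ (-γ)) * (jbr ‖w‖ ^ (-N) * jbr (‖y - s • w‖ - R) ^ (-β)) := by
    intro w hw
    have hw : ‖w‖ < ‖y‖ / 2 := by simpa using hw
    have hd := abs_le.1 (hdiff w)
    have a1 : 0 ≤ jb w := Real.sqrt_nonneg _
    exact aux_pt hα0 (by positivity) hy hR (by linarith) (by linarith)
  -- reduce to one estimate
  suffices H : ∃ g : EuclideanSpace ℝ (Fin n) → ℝ, IntegrableOn g (Metric.ball 0 (‖y‖ / 2)) volume ∧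
      (∀ w ∈ Metric.ball (0 : EuclideanSpace ℝ (Fin n)) (‖y‖ / 2),
        jbr ‖w‖ ^ (-N) * jbr (‖y - s • w‖ - R) ^ (-β) ≤ g w) ∧
      ‖y‖ ^ (-α) * (∫ w in Metric.ball (0 : EuclideanSpace ℝ (Fin n)) (‖y‖ / 2), g w) ≤
        2 ^ α * (K2 * (I + I) + 2 ^ β * V + 1) * jb y ^ (-α) * D ^ (-β) by
    obtain ⟨g, hg, hle, hint⟩ := H
    calc _ ≤ ∫ w in Metric.ball (0 : EuclideanSpace ℝ (Fin n)) (‖y‖ / 2), K1 * (‖y‖ ^ (-α) * G ^ (-γ)) * g w := by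
          apply integral_mono_of_nonneg
          · exact Filter.Eventually.of_forall hnn
          · exact hg.const_mul _
          · refine (ae_restrict_iff' measurableSet_ball).2 (Filter.Eventually.of_forall ?_)
            intro w hw
            refine (hpt w hw).trans ?_
            have := hle w hw
            dsimp only
            gcongr
      _ = K1 * G ^ (-γ) * (‖y‖ ^ (-α) * ∫ w in Metric.ball (0 : EuclideanSpace ℝ (Fin n)) (‖y‖ / 2), g w) := by
          rw [integral_const_mul]; ring
      _ ≤ K1 * G ^ (-γ) *
          (2 ^ α * (K2 * (I + I) + 2 ^ β * V + 1) * jb y ^ (-α) * D ^ (-β)) := by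
          gcongr
      _ = _ := by ring
  rcases le_total 1 ‖y‖ with h1 | h1
  · have hi2 : Integrable (fun w : EuclideanSpace ℝ (Fin n) => f (D⁻¹ • w)) volume :=
      hfi.comp_smul (by positivity)
    have hgi : Integrable (fun w : EuclideanSpace ℝ (Fin n) => K2 * (D ^ (-β) * f w +
        D ^ (-((n : ℝ) + β)) * f (D⁻¹ • w))) volume :=
      ((hfi.const_mul _).add (hi2.const_mul _)).const_mul _
    refine ⟨_, hgi.integrableOn, ?_, ?_⟩
    · intro w hw
      have := aux_B (R := R) hn0 hβ hN (norm_nonneg w) (hdiff w)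
      simp only [hf, norm_smul, norm_inv, Real.norm_of_nonneg hD0.le]
      exact this
    · have b1 : (∫ w in Metric.ball (0 : EuclideanSpace ℝ (Fin n)) (‖y‖ / 2), K2 * (D ^ (-β) * f w +
        D ^ (-((n : ℝ) + β)) * f (D⁻¹ • w))) ≤ K2 * (I + I) * D ^ (-β) := by
        refine (setIntegral_le_integral hgi (Filter.Eventually.of_forall ?_)).trans ?_
        · intro w
          have := hf0 w
          have := hf0 (D⁻¹ • w)
          dsimp only [Pi.zero_apply]
          positivity
        · rw [integral_const_mul, integral_add (hfi.const_mul _) (hi2.const_mul _),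
            integral_const_mul, integral_const_mul, Measure.integral_comp_inv_smul]
          have : D ^ (-((n : ℝ) + β)) * D ^ n = D ^ (-β) := by
            rw [← Real.rpow_natCast, ← Real.rpow_add hD0]; congr 1; ring
          have h3 : Module.finrank ℝ (EuclideanSpace ℝ (Fin n)) = n := finrank_euclideanSpace_fin
          rw [h3, abs_of_nonneg (by positivity), smul_eq_mul, ← mul_assoc (D ^ _), this]
          apply le_of_eq; ring
      have b2 : ‖y‖ ^ (-α) ≤ 2 ^ α * jb y ^ (-α) := by
        refine aux_rpow_neg (by norm_num) hy hy0 ?_ hα0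
        have := aux_jbr_le ‖y‖
        rw [abs_of_nonneg hy.le] at this
        rw [aux_jb_eq]; linarith
      clear_value K1 K2 I V D G
      calc _ ≤ ‖y‖ ^ (-α) * (K2 * (I + I) * D ^ (-β)) := by gcongr
        _ ≤ (2 ^ α * jb y ^ (-α)) * ((K2 * (I + I) + 2 ^ β * V + 1) * D ^ (-β)) := by
          gcongr
          have : 0 ≤ 2 ^ β * V := by positivity
          linarith
        _ = _ := by ring
  · refine ⟨fun _ => 2 ^ β * D ^ (-β), ?_, ?_, ?_⟩
    · exact integrableOn_const (measure_ball_lt_top.ne)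
    · intro w hw
      have hw : ‖w‖ < ‖y‖ / 2 := by simpa using hw
      exact aux_C hβ (by linarith) ((hdiff w).trans (by linarith))
    · rw [setIntegral_const]
      have b1 : volume.real (Metric.ball (0 : EuclideanSpace ℝ (Fin n)) (‖y‖ / 2)) ≤ ‖y‖ ^ (n : ℝ) * V := by
        have h3 : Module.finrank ℝ (EuclideanSpace ℝ (Fin n)) = n := finrank_euclideanSpace_fin
        rw [Measure.real, Measure.addHaar_ball_of_pos _ _ (by positivity), h3, ENNReal.toReal_mul,
          ENNReal.toReal_ofReal (by positivity), Real.rpow_natCast]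
        change (‖y‖ / 2) ^ n * V ≤ _
        gcongr
        linarith
      have b2 : ‖y‖ ^ (-α) * ‖y‖ ^ (n : ℝ) ≤ 1 := by
        rw [← Real.rpow_add hy]
        exact Real.rpow_le_one hy.le h1 (by linarith)
      have b3 : 1 ≤ 2 ^ α * jb y ^ (-α) := by
        have := aux_rpow_neg (a := 1) (b := jb y) (c := 2) (p := α) (by norm_num) (by norm_num)
          hy0 ?_ hα0
        · simpa using this
        · have := aux_jbr_le ‖y‖
          rw [abs_of_nonneg hy.le] at this
          rw [aux_jb_eq]; linarith
      clear_value K1 K2 I V D G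
      calc _ ≤ ‖y‖ ^ (-α) * ((‖y‖ ^ (n : ℝ) * V) * (2 ^ β * D ^ (-β))) := by
            rw [smul_eq_mul]; gcongr
        _ = (‖y‖ ^ (-α) * ‖y‖ ^ (n : ℝ)) * ((2 ^ β * V) * D ^ (-β)) := by ring
        _ ≤ (2 ^ α * jb y ^ (-α)) * ((K2 * (I + I) + 2 ^ β * V + 1) * D ^ (-β)) := by
          have : 0 ≤ K2 * (I + I) := by positivity
          refine mul_le_mul (b2.trans b3) ?_ (by positivity) (by positivity)
          gcongr
          linarith
        _ = _ := by ring
end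

section
/- Let n ≥ 2 be an integer, k ≥ 0, 0 ≤ α < n−1, and N ≥ n+1+k. Then there exists a constant C (depending only on n, k, α, N) such that for every y ∈ ℝⁿ and every R ≥ 0, ∫_{{w ∈ ℝⁿ : |w| > |y|/2}} ⟨w⟩^{-N} / ( ⟨R+|y−w|⟩ ⟨R−|y−w|⟩ |y−w|^α ) dw ≤ C / ( ⟨R+|y|⟩ ⟨R−|y|⟩ ⟨y⟩^{α+k} ). -/
open MeasureTheory Real
open scoped ENNReal

lemma jbr_pos (t : ℝ) : 0 < jbr t := by unfold jbr; positivity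

lemma jbr_sq (t : ℝ) : jbr t ^ 2 = 1 + t ^ 2 := by
  unfold jbr; exact Real.sq_sqrt (by positivity)

lemma jbr_le {a b : ℝ} (h : |a| ≤ |b|) : jbr a ≤ jbr b := by
  unfold jbr
  apply Real.sqrt_le_sqrt
  have := sq_le_sq.2 h
  linarith

lemma abs_le_jbr (a : ℝ) : |a| ≤ jbr a := by
  unfold jbr
  apply Real.abs_le_sqrt
  linarith

lemma one_le_jbr (a : ℝ) : 1 ≤ jbr a := by
  unfold jbr
  rw [Real.one_le_sqrt]
  nlinarith [sq_nonneg a]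

lemma jbr_tri {a b c : ℝ} (h : |a - b| ≤ |c|) : jbr a ≤ jbr b + jbr c := by
  have hb := jbr_pos b
  have hc := jbr_pos c
  apply (pow_le_pow_iff_left₀ (jbr_pos _).le (by positivity) two_ne_zero).1
  have h1 : |a| ≤ |b| + |c| := by
    have := abs_sub_abs_le_abs_sub a b
    linarith
  have h2 : a ^ 2 ≤ (|b| + |c|) ^ 2 := by
    rw [← sq_abs a]; gcongr
  have h3 := mul_le_mul (abs_le_jbr b) (abs_le_jbr c) (abs_nonneg _) hb.le
  nlinarith [jbr_sq a, jbr_sq b, jbr_sq c, sq_abs b, sq_abs c]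

lemma jbr_scale {a b c : ℝ} (hc : 1 ≤ c) (h : |a| ≤ c * |b|) : jbr a ≤ c * jbr b := by
  have hb := jbr_pos b
  apply (pow_le_pow_iff_left₀ (jbr_pos _).le (by positivity) two_ne_zero).1
  have h2 : a ^ 2 ≤ (c * |b|) ^ 2 := by
    rw [← sq_abs a]; gcongr
  rw [mul_pow, jbr_sq, jbr_sq]
  rw [mul_pow, sq_abs] at h2
  nlinarith

/-- pointwise estimate in real variables -/
lemma ptwise (n : ℕ) (hn : 2 ≤ n) (k α N : ℝ) (hk : 0 ≤ k)
    (hα0 : 0 ≤ α) (hα : α < n - 1) (hN : (n : ℝ) + 1 + k ≤ N)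
    (r s w R : ℝ) (hr : 0 ≤ r) (hs : 0 < s) (hw : 0 ≤ w) (hR : 0 ≤ R)
    (hrw : r / 2 < w) (hsr : |s - r| ≤ w) :
    jbr w ^ (-N) / (jbr (R + s) * jbr (R - s) * s ^ α) ≤
      (2 ^ (α + k) * 3 ^ ((n : ℝ) - 1 - α) * 18) /
        (jbr (R + r) * jbr (R - r) * jbr r ^ (α + k)) *
      ((s ^ (n - 1))⁻¹ * ((1 + s ^ 2)⁻¹ + (1 + (R - s) ^ 2)⁻¹)) := by
  have hW := jbr_pos w
  have hX := jbr_pos (R - s)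
  have hY := jbr_pos (R + s)
  have hA := jbr_pos (R + r)
  have hB := jbr_pos (R - r)
  have hJ := jbr_pos r
  have hS := jbr_pos s
  have hsw : s ≤ 3 * w := by have := abs_le.1 hsr; linarith
  have h1 : jbr r ≤ 2 * jbr w := jbr_scale (by norm_num) (by
    rw [abs_of_nonneg hr, abs_of_nonneg hw]; linarith)
  have h2 : jbr s ≤ 3 * jbr w := jbr_scale (by norm_num) (by
    rw [abs_of_nonneg hs.le, abs_of_nonneg hw]; linarith)
  have h3 : s ≤ 3 * jbr w := by
    have := abs_le_jbr s
    rw [abs_of_pos hs] at this; linarith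
  have h4 : jbr (R - r) ≤ jbr (R - s) + jbr w := jbr_tri (by
    rw [abs_of_nonneg hw]; convert hsr using 2; ring)
  have h5 : jbr (R + r) ≤ jbr (R + s) + jbr w := jbr_tri (by
    rw [abs_of_nonneg hw, abs_sub_comm]; convert hsr using 2; ring)
  have h6 : jbr (R - s) ≤ jbr (R + s) := jbr_le (by
    rw [abs_of_nonneg (by positivity : 0 ≤ R + s), abs_le]; constructor <;> linarith)
  rw [← jbr_sq s, ← jbr_sq (R - s)]
  -- the factor with powers
  have p1 : jbr w ^ (-N) * jbr r ^ (α + k) ≤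
      (2 ^ (α + k) * 3 ^ ((n : ℝ) - 1 - α)) * (jbr w ^ 2)⁻¹ * (s ^ ((n : ℝ) - 1 - α))⁻¹ := by
    have e1 : jbr w ^ (-N) ≤ jbr w ^ (-((n : ℝ) + 1 + k)) :=
      Real.rpow_le_rpow_of_exponent_le (one_le_jbr w) (by linarith)
    have e2 : jbr r ^ (α + k) ≤ 2 ^ (α + k) * jbr w ^ (α + k) := by
      rw [← Real.mul_rpow (by norm_num) hW.le]
      exact Real.rpow_le_rpow hJ.le h1 (by linarith)
    have e3 : s ^ ((n : ℝ) - 1 - α) ≤ 3 ^ ((n : ℝ) - 1 - α) * jbr w ^ ((n : ℝ) - 1 - α) := by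
      rw [← Real.mul_rpow (by norm_num) hW.le]
      exact Real.rpow_le_rpow hs.le h3 (by linarith)
    have e4 : jbr w ^ (-((n : ℝ) + 1 + k)) * jbr w ^ (α + k) =
        (jbr w ^ 2)⁻¹ * (jbr w ^ ((n : ℝ) - 1 - α))⁻¹ := by
      rw [← Real.rpow_natCast (jbr w) 2, ← Real.rpow_neg hW.le, ← Real.rpow_neg hW.le,
        ← Real.rpow_add hW, ← Real.rpow_add hW]
      congr 1
      push_cast
      ring
    have hsp : 0 < s ^ ((n : ℝ) - 1 - α) := Real.rpow_pos_of_pos hs _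
    have hwp : 0 < jbr w ^ ((n : ℝ) - 1 - α) := Real.rpow_pos_of_pos hW _
    have e5 : (jbr w ^ ((n : ℝ) - 1 - α))⁻¹ ≤
        3 ^ ((n : ℝ) - 1 - α) * (s ^ ((n : ℝ) - 1 - α))⁻¹ := by
      rw [← div_eq_mul_inv, inv_le_comm₀ hwp (by positivity), inv_div, div_le_iff₀ (by positivity)]
      linarith
    calc jbr w ^ (-N) * jbr r ^ (α + k)
        ≤ jbr w ^ (-((n : ℝ) + 1 + k)) * (2 ^ (α + k) * jbr w ^ (α + k)) := by gcongr
      _ = 2 ^ (α + k) * ((jbr w ^ 2)⁻¹ * (jbr w ^ ((n : ℝ) - 1 - α))⁻¹) := by rw [← e4]; ring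
      _ ≤ 2 ^ (α + k) * ((jbr w ^ 2)⁻¹ *
          (3 ^ ((n : ℝ) - 1 - α) * (s ^ ((n : ℝ) - 1 - α))⁻¹)) := by gcongr
      _ = _ := by ring
  have p2 : (s ^ ((n : ℝ) - 1 - α))⁻¹ * (s ^ α)⁻¹ = (s ^ (n - 1))⁻¹ := by
    rw [← mul_inv, ← Real.rpow_add hs, ← Real.rpow_natCast, Nat.cast_sub (by omega)]
    congr 2
    push_cast
    ring
  have p3 : (jbr (R + r) * jbr (R - r)) * (jbr w ^ 2)⁻¹ * (jbr (R + s) * jbr (R - s))⁻¹ ≤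
      18 * ((jbr s ^ 2)⁻¹ + (jbr (R - s) ^ 2)⁻¹) := by
    have q1 : jbr (R - r) * (jbr w)⁻¹ * (jbr (R - s))⁻¹ ≤ (jbr w)⁻¹ + (jbr (R - s))⁻¹ := by
      calc _ ≤ (jbr (R - s) + jbr w) * (jbr w)⁻¹ * (jbr (R - s))⁻¹ := by gcongr
        _ = _ := by field_simp
    have q2 : jbr (R + r) * (jbr w)⁻¹ * (jbr (R + s))⁻¹ ≤ (jbr w)⁻¹ + (jbr (R - s))⁻¹ := by
      calc _ ≤ (jbr (R + s) + jbr w) * (jbr w)⁻¹ * (jbr (R + s))⁻¹ := by gcongr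
        _ = (jbr w)⁻¹ + (jbr (R + s))⁻¹ := by field_simp
        _ ≤ _ := by gcongr
    have q3 : (jbr w)⁻¹ ≤ 3 * (jbr s)⁻¹ := by
      rw [← div_eq_mul_inv, inv_le_comm₀ hW (by positivity), inv_div, div_le_iff₀ (by positivity)]
      linarith
    calc _ = (jbr (R + r) * (jbr w)⁻¹ * (jbr (R + s))⁻¹) *
          (jbr (R - r) * (jbr w)⁻¹ * (jbr (R - s))⁻¹) := by
            rw [mul_inv, ← inv_pow]; ring
      _ ≤ ((jbr w)⁻¹ + (jbr (R - s))⁻¹) * ((jbr w)⁻¹ + (jbr (R - s))⁻¹) := by gcongr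
      _ ≤ (3 * (jbr s)⁻¹ + (jbr (R - s))⁻¹) * (3 * (jbr s)⁻¹ + (jbr (R - s))⁻¹) := by gcongr
      _ ≤ _ := by
        rw [← inv_pow, ← inv_pow]
        nlinarith [sq_nonneg (3 * (jbr s)⁻¹ - (jbr (R - s))⁻¹), sq_nonneg (jbr (R - s))⁻¹]
  have hP : 0 < jbr r ^ (α + k) := Real.rpow_pos_of_pos hJ _
  have hsa : 0 < s ^ α := Real.rpow_pos_of_pos hs _
  rw [div_mul_eq_mul_div, le_div_iff₀ (by positivity)]
  calc _ = (jbr w ^ (-N) * jbr r ^ (α + k)) * (s ^ α)⁻¹ *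
        ((jbr (R + r) * jbr (R - r)) * (jbr (R + s) * jbr (R - s))⁻¹) := by
          rw [div_eq_mul_inv, mul_inv _ (s ^ α)]; ring
    _ ≤ ((2 ^ (α + k) * 3 ^ ((n : ℝ) - 1 - α)) * (jbr w ^ 2)⁻¹ * (s ^ ((n : ℝ) - 1 - α))⁻¹) *
        (s ^ α)⁻¹ * ((jbr (R + r) * jbr (R - r)) * (jbr (R + s) * jbr (R - s))⁻¹) := by gcongr
    _ = (2 ^ (α + k) * 3 ^ ((n : ℝ) - 1 - α)) * ((s ^ ((n : ℝ) - 1 - α))⁻¹ * (s ^ α)⁻¹) *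
        ((jbr (R + r) * jbr (R - r)) * (jbr w ^ 2)⁻¹ * (jbr (R + s) * jbr (R - s))⁻¹) := by ring
    _ ≤ (2 ^ (α + k) * 3 ^ ((n : ℝ) - 1 - α)) * (s ^ (n - 1))⁻¹ *
        (18 * ((jbr s ^ 2)⁻¹ + (jbr (R - s) ^ 2)⁻¹)) := by
          rw [p2]; gcongr
    _ = _ := by ring

lemma radial (n : ℕ) (hn : 2 ≤ n) (y : EuclideanSpace ℝ (Fin n)) (R : ℝ) :
    Integrable (fun w : EuclideanSpace ℝ (Fin n) =>
      ((‖y - w‖ ^ (n - 1))⁻¹ * ((1 + ‖y - w‖ ^ 2)⁻¹ + (1 + (R - ‖y - w‖) ^ 2)⁻¹))) ∧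
    ∫ w : EuclideanSpace ℝ (Fin n),
      ((‖y - w‖ ^ (n - 1))⁻¹ * ((1 + ‖y - w‖ ^ 2)⁻¹ + (1 + (R - ‖y - w‖) ^ 2)⁻¹)) ≤
      n * (volume.real (Metric.ball (0 : EuclideanSpace ℝ (Fin n)) 1) * (2 * π)) := by
  haveI : NeZero n := ⟨by omega⟩
  haveI : Nontrivial (EuclideanSpace ℝ (Fin n)) := inferInstance
  set h : ℝ → ℝ := fun s => (s ^ (n - 1))⁻¹ * ((1 + s ^ 2)⁻¹ + (1 + (R - s) ^ 2)⁻¹) with hh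
  set q : ℝ → ℝ := fun s => (1 + s ^ 2)⁻¹ + (1 + (R - s) ^ 2)⁻¹ with hq
  have i1 : Integrable (fun s : ℝ => (1 + s ^ 2)⁻¹) := integrable_inv_one_add_sq
  have i2 : Integrable (fun s : ℝ => (1 + (R - s) ^ 2)⁻¹) := i1.comp_sub_left R
  have iq : Integrable q := i1.add i2
  have vq : ∫ s, q s = 2 * π := by
    rw [hq, integral_add i1 i2, integral_sub_left_eq_self (fun s : ℝ => (1 + s ^ 2)⁻¹) volume R,
      integral_univ_inv_one_add_sq]
    ring
  have eqq : ∀ s ∈ Set.Ioi (0 : ℝ), s ^ (n - 1) • h s = q s := by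
    intro s hs
    have : s ^ (n - 1) ≠ 0 := pow_ne_zero _ (ne_of_gt hs)
    simp only [hh, hq, smul_eq_mul]
    rw [mul_inv_cancel_left₀ this]
  have ih : Integrable (fun w : EuclideanSpace ℝ (Fin n) => h ‖w‖) := by
    rw [integrable_fun_norm_addHaar]
    rw [finrank_euclideanSpace_fin]
    exact (integrableOn_congr_fun eqq measurableSet_Ioi).2 iq.integrableOn
  constructor
  · exact ih.comp_sub_left y
  · rw [integral_sub_left_eq_self (fun w : EuclideanSpace ℝ (Fin n) => h ‖w‖) volume y]
    rw [integral_fun_norm_addHaar, finrank_euclideanSpace_fin,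
      setIntegral_congr_fun measurableSet_Ioi eqq]
    simp only [smul_eq_mul, nsmul_eq_mul]
    gcongr
    rw [← vq]
    apply setIntegral_le_integral iq
    filter_upwards with s
    simp only [hq, Pi.zero_apply]
    positivity

theorem stmt_9 (n : ℕ) (hn : 2 ≤ n) (k α N : ℝ) (hk : 0 ≤ k)
    (hα0 : 0 ≤ α) (hα : α < n - 1) (hN : (n : ℝ) + 1 + k ≤ N) :
    ∃ C : ℝ, 0 < C ∧ ∀ y : EuclideanSpace ℝ (Fin n), ∀ R : ℝ, 0 ≤ R →
      (∫ w in {w : EuclideanSpace ℝ (Fin n) | ‖y‖ / 2 < ‖w‖},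
          jb w ^ (-N) / (jbr (R + ‖y - w‖) * jbr (R - ‖y - w‖) * ‖y - w‖ ^ α)) ≤
        C / (jbr (R + ‖y‖) * jbr (R - ‖y‖) * jb y ^ (α + k)) := by
  haveI : NeZero n := ⟨by omega⟩
  haveI : Nontrivial (EuclideanSpace ℝ (Fin n)) := inferInstance
  have hjb : ∀ x : EuclideanSpace ℝ (Fin n), jb x = jbr ‖x‖ := fun x => rfl
  refine ⟨(2 ^ (α + k) * 3 ^ ((n : ℝ) - 1 - α) * 18) *
    (n * (volume.real (Metric.ball (0 : EuclideanSpace ℝ (Fin n)) 1) * (2 * π))) + 1,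
    by positivity, ?_⟩
  intro y R hR
  simp only [hjb]
  obtain ⟨hi, hv⟩ := radial n hn y R
  have hA := jbr_pos (R + ‖y‖)
  have hB := jbr_pos (R - ‖y‖)
  have hJ : 0 < jbr ‖y‖ ^ (α + k) := Real.rpow_pos_of_pos (jbr_pos _) _
  set D := jbr (R + ‖y‖) * jbr (R - ‖y‖) * jbr ‖y‖ ^ (α + k) with hD
  have hDp : 0 < D := by positivity
  set K : ℝ := 2 ^ (α + k) * 3 ^ ((n : ℝ) - 1 - α) * 18 with hK
  have hKp : 0 < K := by positivity
  have hmeas : MeasurableSet {w : EuclideanSpace ℝ (Fin n) | ‖y‖ / 2 < ‖w‖} :=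
    measurableSet_lt measurable_const measurable_norm
  have hne : ∀ᵐ w : EuclideanSpace ℝ (Fin n), w ≠ y := by
    rw [ae_iff]; simp
  calc _ ≤ ∫ w in {w : EuclideanSpace ℝ (Fin n) | ‖y‖ / 2 < ‖w‖}, K / D *
        ((‖y - w‖ ^ (n - 1))⁻¹ * ((1 + ‖y - w‖ ^ 2)⁻¹ + (1 + (R - ‖y - w‖) ^ 2)⁻¹)) := by
        apply integral_mono_of_nonneg
        · filter_upwards with w
          have h1 := jbr_pos ‖w‖
          have h2 := jbr_pos (R + ‖y - w‖)
          have h3 := jbr_pos (R - ‖y - w‖)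
          simp only [Pi.zero_apply]
          positivity
        · exact (hi.const_mul _).integrableOn
        · filter_upwards [ae_restrict_mem hmeas, ae_restrict_of_ae hne] with w hw hwy
          apply ptwise n hn k α N hk hα0 hα hN ‖y‖ ‖y - w‖ ‖w‖ R (norm_nonneg _) _
            (norm_nonneg _) hR hw
          · have := abs_norm_sub_norm_le (y - w) y
            simpa using this
          · exact norm_pos_iff.2 (sub_ne_zero.2 hwy.symm)
    _ ≤ ∫ w : EuclideanSpace ℝ (Fin n), K / D *
        ((‖y - w‖ ^ (n - 1))⁻¹ * ((1 + ‖y - w‖ ^ 2)⁻¹ + (1 + (R - ‖y - w‖) ^ 2)⁻¹)) := by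
        apply setIntegral_le_integral (hi.const_mul _)
        filter_upwards with w
        simp only [Pi.zero_apply]
        positivity
    _ ≤ K / D * (n * (volume.real (Metric.ball (0 : EuclideanSpace ℝ (Fin n)) 1) * (2 * π))) := by
        rw [integral_const_mul]
        gcongr
    _ ≤ _ := by
        rw [div_mul_eq_mul_div]
        gcongr
        linarith
end
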